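/- Let F be a properly parametrized Markov multi-map with forward trajectory space X (with left-shift map T) and associated SFT Σ_M. If Σ_M satisfies the Coding Condition (CC) and the Mixing Condition (MC) with mixing component C₀ ⊇ A^(e), and if the family {g_u : u ∈ L(C₀)} of inverse functions is uniformly equicontinuous, then (X,T) has the specification property. -/

import Mathlib

open Set Topology

/-! ### Generic dynamical notions -/

/-- Topological transitivity of a map. -/
def TopTransitive {α : Type*} [TopologicalSpace α] (T : α → α) : Prop :=
  ∀ U V : Set α, IsOpen U → IsOpen V → U.Nonempty → V.Nonempty →
    ∃ n : ℕ, (T^[n] '' U ∩ V).Nonempty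

/-- Topological mixing of a map. -/
def TopMixing {α : Type*} [TopologicalSpace α] (T : α → α) : Prop :=
  ∀ U V : Set α, IsOpen U → IsOpen V → U.Nonempty → V.Nonempty →
    ∃ N : ℕ, ∀ n, N ≤ n → (T^[n] '' U ∩ V).Nonempty

/-- Density of the set of periodic points of a map. -/
def DensePeriodic {α : Type*} [TopologicalSpace α] (T : α → α) : Prop :=
  Dense {x : α | ∃ p : ℕ, 1 ≤ p ∧ T^[p] x = x}

/-- The metric `d(x,y) = sup_k |x_k - y_k|/(k+1)` on sequence spaces. -/
noncomputable def dseq (x y : ℕ → ℝ) : ℝ := ⨆ k : ℕ, |x k - y k| / ((k : ℝ) + 1)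

/-- The specification property for a map `T` with respect to a distance function `d`. -/
def SpecProp {α : Type*} (T : α → α) (d : α → α → ℝ) : Prop :=
  ∀ ε : ℝ, 0 < ε → ∃ N : ℕ, ∀ l : ℕ, ∀ x : Fin (l + 1) → α, ∀ a b : Fin (l + 1) → ℕ,
    (∀ k, 1 ≤ a k) → (∀ k, a k ≤ b k) →
    (∀ k : Fin l, b k.castSucc < a k.succ ∧ b k.castSucc + N ≤ a k.succ) →
    ∀ p : ℕ, b (Fin.last l) + N ≤ p →
      ∃ z : α, T^[p] z = z ∧
        ∀ k : Fin (l + 1), ∀ i : ℕ, a k ≤ i → i ≤ b k → d (T^[i] z) (T^[i] (x k)) < ε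

/-- The length `ℓ` of a (possibly degenerate) interval. -/
noncomputable def intervalLen (I : Set ℝ) : ℝ := sSup I - sInf I

/-! ### Markov multi-maps -/

/-- A Markov multi-map of the interval, given by a tuple
`(P, A₀, A₁, A₂, D, R, {f_a})` as in the paper, together with the derived data
(inverse maps `g`, interiors `D0`, `R0`, graphs `Gr`, `G0`) which are uniquely
determined by the defining equations below. -/
structure MarkovMultiMap where
  A : Type
  finA : Finite A
  A0 : Set A
  A1 : Set A
  A2 : Set A
  P : Finset ℝ
  D : A → Set ℝ
  R : A → Set ℝ
  f : A → ℝ → ℝ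
  g : A → ℝ → ℝ
  D0 : A → Set ℝ
  R0 : A → Set ℝ
  Gr : A → Set (ℝ × ℝ)
  G0 : A → Set (ℝ × ℝ)
  P_zero : (0 : ℝ) ∈ P
  P_one : (1 : ℝ) ∈ P
  P_sub : (P : Set ℝ) ⊆ Set.Icc 0 1
  A_cover : ∀ a : A, a ∈ A0 ∨ a ∈ A1 ∨ a ∈ A2
  A01 : A0 ∩ A1 = ∅
  A02 : A0 ∩ A2 = ∅
  A12 : A1 ∩ A2 = ∅
  D_A0 : ∀ a ∈ A0, ∃ p ∈ P, ∃ q ∈ P, p < q ∧ (∀ r ∈ P, ¬(p < r ∧ r < q)) ∧ D a = Set.Icc p q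
  D_A12 : ∀ a ∈ A1 ∪ A2, ∃ p ∈ P, D a = {p}
  R_A0 : ∀ a ∈ A0, ∃ u ∈ P, ∃ v ∈ P, u < v ∧ R a = Set.Icc u v
  R_A1 : ∀ a ∈ A1, ∃ u ∈ P, ∃ v ∈ P, u < v ∧ R a = Set.Icc u v ∧
    Set.Icc u v ∩ (P : Set ℝ) = {u, v}
  R_A2 : ∀ a ∈ A2, ∃ u ∈ P, R a = {u}
  f_homeo : ∀ a ∈ A0, ContinuousOn (f a) (D a) ∧ Set.BijOn (f a) (D a) (R a)
  g_A0 : ∀ a ∈ A0, (∀ x ∈ D a, g a (f a x) = x) ∧ ∀ y ∈ R a, g a y ∈ D a ∧ f a (g a y) = y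
  g_A12 : ∀ a ∈ A1 ∪ A2, ∀ y ∈ R a, g a y ∈ D a
  cover : Set.Icc (0 : ℝ) 1 = ⋃ a : A, D a
  D0_A0 : ∀ a ∈ A0, D0 a = interior (D a)
  D0_A12 : ∀ a ∈ A1 ∪ A2, D0 a = D a
  R0_A01 : ∀ a ∈ A0 ∪ A1, R0 a = interior (R a)
  R0_A2 : ∀ a ∈ A2, R0 a = R a
  Gr_A0 : ∀ a ∈ A0, Gr a = {q : ℝ × ℝ | q.1 ∈ D a ∧ q.2 = f a q.1}
  Gr_A12 : ∀ a ∈ A1 ∪ A2, Gr a = (D a) ×ˢ (R a)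
  G0_A0 : ∀ a ∈ A0, G0 a = {q : ℝ × ℝ | q.1 ∈ D0 a ∧ q.2 = f a q.1}
  G0_A1 : ∀ a ∈ A1, G0 a = (D a) ×ˢ (R0 a)
  G0_A2 : ∀ a ∈ A2, G0 a = Gr a

namespace MarkovMultiMap

variable (M : MarkovMultiMap)

/-- The graph `G(F)` of the multi-map. -/
def GF : Set (ℝ × ℝ) := ⋃ a : M.A, M.Gr a

/-- `F` is properly parametrized: the sets `G₀(a)` partition `G(F)`. -/
def ProperlyParametrized : Prop :=
  (⋃ a : M.A, M.G0 a) = M.GF ∧ ∀ a b : M.A, a ≠ b → Disjoint (M.G0 a) (M.G0 b)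

/-- The forward trajectory space `X`. -/
def X : Set (ℕ → ℝ) :=
  {x | (∀ k, x k ∈ Set.Icc (0 : ℝ) 1) ∧ ∀ k, (x k, x (k + 1)) ∈ M.GF}

/-- The left-shift map `T` on the forward trajectory space. -/
def shift : M.X → M.X :=
  fun x => ⟨fun k => x.1 (k + 1), ⟨fun k => x.2.1 (k + 1), fun k => x.2.2 (k + 1)⟩⟩

/-- The inverse trajectory (inverse limit) space `Y`, encoded by `y k = y_{-k}`. -/
def Y : Set (ℕ → ℝ) :=
  {y | (∀ k, y k ∈ Set.Icc (0 : ℝ) 1) ∧ ∀ k, (y (k + 1), y k) ∈ M.GF}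

/-- The right-shift map `S` on the inverse limit space (in the encoding `y k = y_{-k}`). -/
def ishift : M.Y → M.Y :=
  fun y => ⟨fun k => y.1 (k + 1), ⟨fun k => y.2.1 (k + 1), fun k => y.2.2 (k + 1)⟩⟩

/-- The space `X_n` of finite trajectories of length `n`. -/
def finTraj (n : ℕ) : Set (Fin n → ℝ) :=
  {x | (∀ i, x i ∈ Set.Icc (0 : ℝ) 1) ∧
    ∀ i : Fin n, ∀ h : (i : ℕ) + 1 < n, (x i, x ⟨(i : ℕ) + 1, h⟩) ∈ M.GF}

/-- The associated nearest-neighbor SFT `Σ_M`. -/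
def SFT : Set (ℕ → M.A) := {a | ∀ n : ℕ, M.D0 (a (n + 1)) ⊆ M.R0 (a n)}

/-- The word `u` (of length `n`) occurs in some point of `Z`. -/
def WordIn {n : ℕ} (u : Fin n → M.A) (Z : Set (ℕ → M.A)) : Prop :=
  ∃ z ∈ Z, ∃ m : ℕ, ∀ i : Fin n, u i = z (m + (i : ℕ))

/-- `L_n`, the words of length `n` in the language of `Σ_M`. -/
def Lang (n : ℕ) : Set (Fin n → M.A) := {u | M.WordIn u M.SFT}

/-- `(x,u)` is a labeled finite trajectory: `(x_k, x_{k+1}) ∈ G(u_k)` for all `k`. -/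
def Labeled {n : ℕ} (x : Fin (n + 1) → ℝ) (u : Fin n → M.A) : Prop :=
  ∀ i : Fin n, (x i.castSucc, x i.succ) ∈ M.Gr (u i)

/-- `(x,u)` is a special labeled finite trajectory: `(x_k, x_{k+1}) ∈ G₀(u_k)` for all `k`. -/
def SpecialLabeled {n : ℕ} (x : Fin (n + 1) → ℝ) (u : Fin n → M.A) : Prop :=
  ∀ i : Fin n, (x i.castSucc, x i.succ) ∈ M.G0 (u i)

/-- A word `u ∈ L_n` is essential if the set of finite trajectories specially labeled
by `u` is open in `X_{n+1}`. -/
def EssentialWord {n : ℕ} (u : Fin n → M.A) : Prop :=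
  u ∈ M.Lang n ∧ IsOpen {x : M.finTraj (n + 1) | M.SpecialLabeled x.1 u}

/-- A symbol is essential if it appears in some essential word. -/
def EssentialSymbol (a : M.A) : Prop :=
  ∃ n : ℕ, ∃ u : Fin n → M.A, M.EssentialWord u ∧ ∃ i : Fin n, u i = a

/-- `A^(e)`, the set of essential symbols. -/
def Ess : Set M.A := {a | M.EssentialSymbol a}

/-- `E`, the set of essential symbolic sequences. -/
def E : Set (ℕ → M.A) := {z ∈ M.SFT | ∀ i : ℕ, z i ∈ M.Ess}

/-- A word all of whose letters lie in `C`, in the language of `Σ_M`. -/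
def WordOver {n : ℕ} (u : Fin n → M.A) (C : Set M.A) : Prop :=
  u ∈ M.Lang n ∧ ∀ i, u i ∈ C

/-- There is a word of length `n+1` over `C` beginning with `a` and ending with `b`. -/
def WordFromTo (C : Set M.A) (a b : M.A) (n : ℕ) : Prop :=
  ∃ u : Fin (n + 1) → M.A, M.WordOver u C ∧ u 0 = a ∧ u (Fin.last n) = b

/-- `C ⊆ A` is irreducible. -/
def IrreducibleSet (C : Set M.A) : Prop :=
  ∀ a ∈ C, ∀ b ∈ C, ∃ n : ℕ, M.WordFromTo C a b n

/-- `C` is an irreducible component (a maximal irreducible subset of `A`). -/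
def IrreducibleComponent (C : Set M.A) : Prop :=
  M.IrreducibleSet C ∧ ∀ C' : Set M.A, M.IrreducibleSet C' → C ⊆ C' → C' = C

/-- `C ⊆ A` is mixing. -/
def MixingSet (C : Set M.A) : Prop :=
  ∃ N : ℕ, 1 ≤ N ∧ ∀ a ∈ C, ∀ b ∈ C, ∀ n : ℕ, N ≤ n + 1 → M.WordFromTo C a b n

/-- `C` is a mixing component (a maximal mixing subset of `A`). -/
def MixingComponent (C : Set M.A) : Prop :=
  M.MixingSet C ∧ ∀ C' : Set M.A, M.MixingSet C' → C ⊆ C' → C' = C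

/-- The Irreducibility Condition (IC). -/
def IC : Prop := ∃ C : Set M.A, M.IrreducibleComponent C ∧ M.Ess ⊆ C

/-- The Mixing Condition (MC). -/
def MC : Prop := ∃ C : Set M.A, M.MixingComponent C ∧ M.Ess ⊆ C

/-- `Z` is a subshift of `Σ_M`: shift-invariant and closed in the product of discrete
topologies (closedness phrased combinatorially). -/
def IsSubshift (Z : Set (ℕ → M.A)) : Prop :=
  Z ⊆ M.SFT ∧ (∀ z ∈ Z, (fun k => z (k + 1)) ∈ Z) ∧
  ∀ x : ℕ → M.A, (∀ n : ℕ, ∃ z ∈ Z, ∀ i, i < n → z i = x i) → x ∈ Z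

/-- The symbol `a` occurs in some point of `Z`. -/
def SymbolInShift (Z : Set (ℕ → M.A)) (a : M.A) : Prop := ∃ z ∈ Z, ∃ k : ℕ, z k = a

/-- `Z` is transitive on symbols. -/
def TransitiveOnSymbols (Z : Set (ℕ → M.A)) : Prop :=
  ∀ a b : M.A, M.SymbolInShift Z a → M.SymbolInShift Z b →
    ∃ z ∈ Z, ∃ m n : ℕ, z m = a ∧ z (m + n) = b

end MarkovMultiMap

/-- The composition `g_{u₀} ∘ ⋯ ∘ g_{u_n}` of inverse maps along a list of symbols. -/
def gWordList (M : MarkovMultiMap) : List M.A → ℝ → ℝ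
  | [], x => x
  | a :: l, x => M.g a (gWordList M l x)

namespace MarkovMultiMap

/-- The inverse map `g_u` associated to a word `u = u₀⋯u_n`. -/
def gWord (M : MarkovMultiMap) {n : ℕ} (u : Fin (n + 1) → M.A) : ℝ → ℝ :=
  gWordList M (List.ofFn u)

/-- The interval `I_u = g_u(R(u_n))`. -/
def Iword (M : MarkovMultiMap) {n : ℕ} (u : Fin (n + 1) → M.A) : Set ℝ :=
  M.gWord u '' M.R (u (Fin.last n))

/-- The Coding Condition (CC). -/
def CC (M : MarkovMultiMap) : Prop :=
  ∃ Z : Set (ℕ → M.A), M.IsSubshift Z ∧ M.TransitiveOnSymbols Z ∧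
    (∀ y ∈ Set.Icc (0 : ℝ) 1, ∃ a ∈ Z, ∃ x ∈ M.X, x 0 = y ∧
      ∀ i : ℕ, (x i, x (i + 1)) ∈ M.Gr (a i)) ∧
    (∀ ε : ℝ, 0 < ε → ∃ N : ℕ, ∀ n : ℕ, N ≤ n → ∀ u : Fin (n + 1) → M.A,
      M.WordIn u Z → intervalLen (M.Iword u) < ε)

/-- Uniform equicontinuity of the family `{g_u : u ∈ L(C)}`. -/
def UnifEquicontOn (M : MarkovMultiMap) (C : Set M.A) : Prop :=
  ∀ ε : ℝ, 0 < ε → ∃ δ : ℝ, 0 < δ ∧ ∀ n : ℕ, ∀ u : Fin (n + 1) → M.A, M.WordOver u C →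
    ∀ x ∈ M.R (u (Fin.last n)), ∀ y ∈ M.R (u (Fin.last n)),
      |x - y| < δ → |M.gWord u x - M.gWord u y| < ε

end MarkovMultiMap

namespace MarkovMultiMap

variable {M : MarkovMultiMap}

/-- The symbol `b` may follow the symbol `a` in the associated SFT. -/
def Adm (M : MarkovMultiMap) (a b : M.A) : Prop := M.D0 b ⊆ M.R0 a

/-- On the index interval `[α, β]` the sequence `w` is admissible and has its letters in `C`. -/
def AdmOn (M : MarkovMultiMap) (C : Set M.A) (w : ℕ → M.A) (α β : ℕ) : Prop :=
  (∀ i, α ≤ i → i ≤ β → w i ∈ C) ∧ ∀ i, α ≤ i → i < β → M.Adm (w i) (w (i + 1))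

/-! ### Local structure of the graphs -/

lemma shape_A0 {a : M.A} (ha : a ∈ M.A0) : ∃ p ∈ M.P, ∃ q ∈ M.P, ∃ u ∈ M.P, ∃ v ∈ M.P,
    p < q ∧ u < v ∧ (∀ r ∈ M.P, ¬(p < r ∧ r < q)) ∧ M.D a = Icc p q ∧ M.D0 a = Ioo p q ∧
    M.R a = Icc u v ∧ M.R0 a = Ioo u v := by
  obtain ⟨p, hp, q, hq, hpq, hr, hD⟩ := M.D_A0 a ha
  obtain ⟨u, hu, v, hv, huv, hR⟩ := M.R_A0 a ha
  refine ⟨p, hp, q, hq, u, hu, v, hv, hpq, huv, hr, hD, ?_, hR, ?_⟩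
  · rw [M.D0_A0 a ha, hD, interior_Icc]
  · rw [M.R0_A01 a (Or.inl ha), hR, interior_Icc]

lemma shape_A1 {a : M.A} (ha : a ∈ M.A1) : ∃ p ∈ M.P, ∃ u ∈ M.P, ∃ v ∈ M.P,
    u < v ∧ M.D a = {p} ∧ M.D0 a = {p} ∧ M.R a = Icc u v ∧ M.R0 a = Ioo u v ∧
    ∀ r ∈ M.P, r ∉ Ioo u v := by
  obtain ⟨p, hp, hD⟩ := M.D_A12 a (Or.inl ha)
  obtain ⟨u, hu, v, hv, huv, hR, hP⟩ := M.R_A1 a ha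
  refine ⟨p, hp, u, hu, v, hv, huv, hD, ?_, hR, ?_, fun r hr hruv => ?_⟩
  · rw [M.D0_A12 a (Or.inl ha), hD]
  · rw [M.R0_A01 a (Or.inr ha), hR, interior_Icc]
  · have : r ∈ ({u, v} : Set ℝ) := hP ▸ ⟨Ioo_subset_Icc_self hruv, hr⟩
    rcases this with rfl | h
    · exact lt_irrefl _ hruv.1
    · exact hruv.2.ne h

lemma shape_A2 {a : M.A} (ha : a ∈ M.A2) : ∃ p ∈ M.P, ∃ u ∈ M.P,
    M.D a = {p} ∧ M.D0 a = {p} ∧ M.R a = {u} ∧ M.R0 a = {u} := by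
  obtain ⟨p, hp, hD⟩ := M.D_A12 a (Or.inr ha)
  obtain ⟨u, hu, hR⟩ := M.R_A2 a ha
  exact ⟨p, hp, u, hu, hD, by rw [M.D0_A12 a (Or.inr ha), hD], hR, by rw [M.R0_A2 a ha, hR]⟩

lemma D_shape (a : M.A) : (∃ p ∈ M.P, M.D a = {p} ∧ M.D0 a = {p}) ∨
    ∃ p ∈ M.P, ∃ q ∈ M.P, p < q ∧ (∀ r ∈ M.P, ¬(p < r ∧ r < q)) ∧
      M.D a = Icc p q ∧ M.D0 a = Ioo p q := by
  rcases M.A_cover a with ha | ha | ha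
  · obtain ⟨p, hp, q, hq, u, hu, v, hv, hpq, -, hr, hD, hD0, -⟩ := shape_A0 ha
    exact Or.inr ⟨p, hp, q, hq, hpq, hr, hD, hD0⟩
  · obtain ⟨p, hp, u, -, v, -, -, hD, hD0, -⟩ := shape_A1 ha
    exact Or.inl ⟨p, hp, hD, hD0⟩
  · obtain ⟨p, hp, u, -, hD, hD0, -⟩ := shape_A2 ha
    exact Or.inl ⟨p, hp, hD, hD0⟩

lemma R_shape (a : M.A) : (∃ u ∈ M.P, M.R a = {u} ∧ M.R0 a = {u}) ∨
    ∃ u ∈ M.P, ∃ v ∈ M.P, u < v ∧ M.R a = Icc u v ∧ M.R0 a = Ioo u v := by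
  rcases M.A_cover a with ha | ha | ha
  · obtain ⟨p, hp, q, hq, u, hu, v, hv, -, huv, -, -, -, hR, hR0⟩ := shape_A0 ha
    exact Or.inr ⟨u, hu, v, hv, huv, hR, hR0⟩
  · obtain ⟨p, hp, u, hu, v, hv, huv, -, -, hR, hR0, -⟩ := shape_A1 ha
    exact Or.inr ⟨u, hu, v, hv, huv, hR, hR0⟩
  · obtain ⟨p, hp, u, hu, -, -, hR, hR0⟩ := shape_A2 ha
    exact Or.inl ⟨u, hu, hR, hR0⟩

lemma D_subset (a : M.A) : M.D a ⊆ Icc 0 1 := by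
  rw [M.cover]
  exact subset_iUnion M.D a

lemma R_subset (a : M.A) : M.R a ⊆ Icc 0 1 := by
  rcases R_shape a with ⟨u, hu, hR, -⟩ | ⟨u, hu, v, hv, -, hR, -⟩
  · rw [hR, singleton_subset_iff]
    exact M.P_sub hu
  · rw [hR]
    exact Icc_subset_Icc (M.P_sub hu).1 (M.P_sub hv).2

lemma R0_subset_R (a : M.A) : M.R0 a ⊆ M.R a := by
  rcases R_shape a with ⟨u, hu, hR, hR0⟩ | ⟨u, hu, v, hv, -, hR, hR0⟩
  · rw [hR, hR0]
  · rw [hR, hR0]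
    exact Ioo_subset_Icc_self

lemma R0_nonempty (a : M.A) : (M.R0 a).Nonempty := by
  rcases R_shape a with ⟨u, hu, hR, hR0⟩ | ⟨u, hu, v, hv, huv, hR, hR0⟩
  · rw [hR0]
    exact singleton_nonempty u
  · rw [hR0]
    exact nonempty_Ioo.2 huv

lemma D_subset_closure_D0 (a : M.A) : M.D a ⊆ closure (M.D0 a) := by
  rcases D_shape a with ⟨p, -, hD, hD0⟩ | ⟨p, -, q, -, hpq, -, hD, hD0⟩
  · rw [hD, hD0]
    exact subset_closure
  · rw [hD, hD0, closure_Ioo hpq.ne]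

lemma isClosed_R (a : M.A) : IsClosed (M.R a) := by
  rcases R_shape a with ⟨u, hu, hR, -⟩ | ⟨u, hu, v, hv, -, hR, -⟩
  · rw [hR]
    exact isClosed_singleton
  · rw [hR]
    exact isClosed_Icc

lemma Adm.D_subset_R {a b : M.A} (h : M.Adm a b) : M.D b ⊆ M.R a :=
  (D_subset_closure_D0 b).trans (closure_minimal (h.trans (R0_subset_R a)) (isClosed_R a))

lemma adm_of_mem {a b : M.A} {t : ℝ} (hR : t ∈ M.R0 a) (hD : t ∈ M.D0 b) : M.Adm a b := by
  unfold Adm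
  rcases D_shape b with ⟨p, hp, -, hD0⟩ | ⟨p, hp, q, hq, hpq, hr, -, hD0⟩
  · rw [hD0] at hD ⊢
    rw [singleton_subset_iff]
    exact mem_singleton_iff.1 hD ▸ hR
  · rw [hD0] at hD ⊢
    rcases R_shape a with ⟨u, hu, -, hR0⟩ | ⟨u, hu, v, hv, huv, -, hR0⟩
    · rw [hR0] at hR
      exact absurd (mem_singleton_iff.1 hR ▸ hD) (hr u hu)
    · rw [hR0] at hR ⊢
      apply Ioo_subset_Ioo
      · by_contra! h
        exact hr u hu ⟨h, hR.1.trans hD.2⟩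
      · by_contra! h
        exact hr v hv ⟨hD.1.trans hR.2, h⟩

/-- The map `f a` sends the endpoints of its domain to the endpoints of its range, and the
interior to the interior. -/
lemma f_endpoints {a : M.A} (ha : a ∈ M.A0) {p q u v : ℝ} (hpq : p < q) (huv : u < v)
    (hD : M.D a = Icc p q) (hR : M.R a = Icc u v) :
    (M.f a p = u ∨ M.f a p = v) ∧ (M.f a q = u ∨ M.f a q = v) ∧
      ∀ x ∈ Ioo p q, M.f a x ∈ Ioo u v := by
  obtain ⟨hc, hb⟩ := M.f_homeo a ha
  rw [hD] at hc hb
  rw [hR] at hb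
  have hpI : p ∈ Icc p q := left_mem_Icc.2 hpq.le
  have hqI : q ∈ Icc p q := right_mem_Icc.2 hpq.le
  obtain ⟨s, hs, hsu⟩ := hb.surjOn (left_mem_Icc.2 huv.le)
  obtain ⟨t, ht, htv⟩ := hb.surjOn (right_mem_Icc.2 huv.le)
  have hp := hb.mapsTo hpI
  have hq := hb.mapsTo hqI
  rcases hc.strictMonoOn_of_injOn_Icc' hpq.le hb.injOn with h | h
  · have h1 : M.f a p = u := le_antisymm (hsu ▸ h.monotoneOn hpI hs hs.1) hp.1
    have h2 : M.f a q = v := le_antisymm hq.2 (htv ▸ h.monotoneOn ht hqI ht.2)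
    refine ⟨Or.inl h1, Or.inr h2, fun x hx => ⟨?_, ?_⟩⟩
    · exact h1 ▸ h hpI (Ioo_subset_Icc_self hx) hx.1
    · exact h2 ▸ h (Ioo_subset_Icc_self hx) hqI hx.2
  · have h1 : M.f a p = v := le_antisymm hp.2 (htv ▸ h.antitoneOn hpI ht ht.1)
    have h2 : M.f a q = u := le_antisymm (hsu ▸ h.antitoneOn hs hqI hs.2) hq.1
    refine ⟨Or.inr h1, Or.inl h2, fun x hx => ⟨?_, ?_⟩⟩
    · exact h2 ▸ h (Ioo_subset_Icc_self hx) hqI hx.2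
    · exact h1 ▸ h hpI (Ioo_subset_Icc_self hx) hx.1

lemma mem_of_mem_G0 {a : M.A} {q : ℝ × ℝ} (h : q ∈ M.G0 a) : q.1 ∈ M.D0 a ∧ q.2 ∈ M.R0 a := by
  rcases M.A_cover a with ha | ha | ha
  · obtain ⟨p, -, r, -, u, -, v, -, hpq, huv, -, hD, hD0, hR, hR0⟩ := shape_A0 ha
    rw [M.G0_A0 a ha] at h
    refine ⟨h.1, ?_⟩
    rw [h.2, hR0]
    exact (f_endpoints ha hpq huv hD hR).2.2 _ (hD0 ▸ h.1)
  · rw [M.G0_A1 a ha] at h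
    rw [M.D0_A12 a (Or.inl ha)]
    exact h
  · rw [M.G0_A2 a ha, M.Gr_A12 a (Or.inr ha)] at h
    rw [M.D0_A12 a (Or.inr ha), M.R0_A2 a ha]
    exact h

lemma G0_subset_Gr (a : M.A) : M.G0 a ⊆ M.Gr a := by
  rcases M.A_cover a with ha | ha | ha
  · rw [M.G0_A0 a ha, M.Gr_A0 a ha, M.D0_A0 a ha]
    exact fun q h => ⟨interior_subset h.1, h.2⟩
  · rw [M.G0_A1 a ha, M.Gr_A12 a (Or.inl ha)]
    exact prod_mono_right (R0_subset_R a)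
  · rw [M.G0_A2 a ha]

lemma isClosed_Gr (a : M.A) : IsClosed (M.Gr a) := by
  by_cases ha : a ∈ M.A0
  · obtain ⟨p, -, r, -, u, -, v, -, -, -, -, hD, -⟩ := shape_A0 ha
    have hc := (M.f_homeo a ha).1
    rw [hD] at hc
    have : M.Gr a = (fun x => (x, M.f a x)) '' Icc p r := by
      rw [M.Gr_A0 a ha, hD]
      ext ⟨x, y⟩
      simp only [mem_ofPred_eq, mem_image, Prod.mk.injEq]
      constructor
      · rintro ⟨h1, h2⟩
        exact ⟨x, h1, rfl, h2.symm⟩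
      · rintro ⟨x', h1, rfl, h2⟩
        exact ⟨h1, h2.symm⟩
    rw [this]
    exact (isCompact_Icc.image_of_continuousOn (continuousOn_id.prodMk hc)).isClosed
  · have ha : a ∈ M.A1 ∪ M.A2 := (M.A_cover a).resolve_left ha
    rw [M.Gr_A12 a ha]
    obtain ⟨p, -, hD⟩ := M.D_A12 a ha
    rw [hD]
    exact isClosed_singleton.prod (isClosed_R a)

lemma mem_P_of_mem_Gr {a : M.A} {q : ℝ × ℝ} (h : q ∈ M.Gr a) (h0 : q ∉ M.G0 a) :
    a ∉ M.A2 ∧ q.1 ∈ M.P ∧ q.2 ∈ M.P := by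
  rcases M.A_cover a with ha | ha | ha
  · obtain ⟨p, hp, r, hr, u, hu, v, hv, hpq, huv, -, hD, hD0, hR, -⟩ := shape_A0 ha
    rw [M.Gr_A0 a ha, hD] at h
    rw [M.G0_A0 a ha, hD0] at h0
    obtain ⟨hx, hy⟩ := h
    obtain ⟨h1, h2, -⟩ := f_endpoints ha hpq huv hD hR
    refine ⟨fun ha2 => (M.A02 ▸ (⟨ha, ha2⟩ : a ∈ M.A0 ∩ M.A2) : a ∈ (∅ : Set M.A)), ?_⟩
    have hx0 : q.1 ∉ Ioo p r := fun h' => h0 ⟨h', hy⟩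
    rcases eq_endpoints_or_mem_Ioo_of_mem_Icc hx with h' | h' | h'
    · rw [hy, h']
      refine ⟨hp, ?_⟩
      rcases h1 with h1 | h1 <;> rw [h1] <;> assumption
    · rw [hy, h']
      refine ⟨hr, ?_⟩
      rcases h2 with h2 | h2 <;> rw [h2] <;> assumption
    · exact absurd h' hx0
  · obtain ⟨p, hp, u, hu, v, hv, huv, hD, hD0, hR, hR0, -⟩ := shape_A1 ha
    rw [M.Gr_A12 a (Or.inl ha), hD, hR] at h
    rw [M.G0_A1 a ha, hD, hR0] at h0
    refine ⟨fun ha2 => (M.A12 ▸ (⟨ha, ha2⟩ : a ∈ M.A1 ∩ M.A2) : a ∈ (∅ : Set M.A)), ?_, ?_⟩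
    · rw [mem_singleton_iff.1 h.1]
      exact hp
    · rcases eq_endpoints_or_mem_Ioo_of_mem_Icc h.2 with h' | h' | h'
      · rwa [h']
      · rwa [h']
      · exact absurd ⟨h.1, h'⟩ h0
  · rw [M.G0_A2 a ha] at h0
    exact absurd h h0

lemma mem_A2_of_mem_G0 {a : M.A} {q : ℝ × ℝ} (h : q ∈ M.G0 a) (h1 : q.1 ∈ M.P)
    (h2 : q.2 ∈ M.P) : a ∈ M.A2 := by
  have hm := mem_of_mem_G0 h
  rcases M.A_cover a with ha | ha | ha
  · obtain ⟨p, hp, r, hr, u, hu, v, hv, hpq, huv, hP, -, hD0, -⟩ := shape_A0 ha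
    rw [hD0] at hm
    exact absurd hm.1 (hP _ h1)
  · obtain ⟨p, hp, u, hu, v, hv, huv, hD, hD0, hR, hR0, hP⟩ := shape_A1 ha
    exact absurd (hR0 ▸ hm.2) (hP _ h2)
  · exact ha

lemma mem_Gr_iff {a : M.A} {x y : ℝ} : (x, y) ∈ M.Gr a ↔ y ∈ M.R a ∧ x = M.g a y := by
  by_cases ha : a ∈ M.A0
  · obtain ⟨h1, h2⟩ := M.g_A0 a ha
    rw [M.Gr_A0 a ha]
    constructor
    · rintro ⟨hx, hy⟩
      obtain rfl : y = M.f a x := hy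
      exact ⟨(M.f_homeo a ha).2.mapsTo hx, (h1 x hx).symm⟩
    · rintro ⟨hy, rfl⟩
      exact ⟨(h2 y hy).1, (h2 y hy).2.symm⟩
  · have ha : a ∈ M.A1 ∪ M.A2 := (M.A_cover a).resolve_left ha
    have hg := M.g_A12 a ha
    obtain ⟨p, -, hD⟩ := M.D_A12 a ha
    rw [M.Gr_A12 a ha]
    rw [hD] at hg ⊢
    constructor
    · rintro ⟨hx, hy⟩
      exact ⟨hy, (mem_singleton_iff.1 hx).trans (mem_singleton_iff.1 (hg y hy)).symm⟩
    · rintro ⟨hy, rfl⟩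
      exact ⟨hg y hy, hy⟩

lemma g_mem_D {a : M.A} {y : ℝ} (hy : y ∈ M.R a) : M.g a y ∈ M.D a := by
  by_cases ha : a ∈ M.A0
  · exact ((M.g_A0 a ha).2 y hy).1
  · exact M.g_A12 a ((M.A_cover a).resolve_left ha) y hy

lemma mem_D_of_mem_Gr {a : M.A} {x y : ℝ} (h : (x, y) ∈ M.Gr a) : x ∈ M.D a := by
  obtain ⟨hy, rfl⟩ := mem_Gr_iff.1 h
  exact g_mem_D hy

lemma exists_mem_G0 (hpp : M.ProperlyParametrized) {q : ℝ × ℝ} (hq : q ∈ M.GF) :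
    ∃ a, q ∈ M.G0 a := by
  rw [← hpp.1] at hq
  exact mem_iUnion.1 hq

/-- A point of `G₀(a)` on the graph of another symbol `b` is an endpoint of `G(b)`. -/
lemma eq_or_mem_A2 (hpp : M.ProperlyParametrized) {a b : M.A} {q : ℝ × ℝ} (ha : q ∈ M.G0 a)
    (hb : q ∈ M.Gr b) : a = b ∨ (a ∈ M.A2 ∧ b ∉ M.A2) := by
  by_cases hab : a = b
  · exact Or.inl hab
  · have hb0 : q ∉ M.G0 b := fun h => (hpp.2 a b hab).le_bot ⟨ha, h⟩
    obtain ⟨h1, h2, h3⟩ := mem_P_of_mem_Gr hb hb0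
    exact Or.inr ⟨mem_A2_of_mem_G0 ha h2 h3, h1⟩

lemma eq_of_mem_Gr_A2 {a : M.A} (ha : a ∈ M.A2) {q r : ℝ × ℝ} (hq : q ∈ M.Gr a)
    (hr : r ∈ M.Gr a) : q = r := by
  obtain ⟨p, -, u, -, hD, -, hR, -⟩ := shape_A2 ha
  rw [M.Gr_A12 a (Or.inr ha), hD, hR, singleton_prod_singleton] at hq hr
  exact (mem_singleton_iff.1 hq).trans (mem_singleton_iff.1 hr).symm

lemma exists_mem_GF {x : ℝ} (hx : x ∈ Icc (0 : ℝ) 1) : ∃ y, (x, y) ∈ M.GF := by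
  rw [M.cover] at hx
  obtain ⟨a, ha⟩ := mem_iUnion.1 hx
  suffices ∃ y, (x, y) ∈ M.Gr a from this.imp fun y hy => mem_iUnion.2 ⟨a, hy⟩
  by_cases h0 : a ∈ M.A0
  · rw [M.Gr_A0 a h0]
    exact ⟨M.f a x, ha, rfl⟩
  · obtain ⟨y, hy⟩ := R0_nonempty a
    rw [M.Gr_A12 a ((M.A_cover a).resolve_left h0)]
    exact ⟨y, ha, R0_subset_R a hy⟩

/-! ### Admissible words -/

lemma exists_adm (hpp : M.ProperlyParametrized) (a : M.A) : ∃ b, M.Adm a b := by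
  obtain ⟨t, ht⟩ := R0_nonempty a
  obtain ⟨y, hy⟩ := exists_mem_GF (M := M) (R_subset a (R0_subset_R a ht))
  obtain ⟨b, hb⟩ := exists_mem_G0 hpp hy
  exact ⟨b, adm_of_mem ht (mem_of_mem_G0 hb).1⟩

lemma word_mem_Lang (hpp : M.ProperlyParametrized) {w : ℕ → M.A} {j n : ℕ}
    (h : ∀ i, j ≤ i → i < j + n → M.Adm (w i) (w (i + 1))) :
    (fun i : Fin (n + 1) => w (j + i)) ∈ M.Lang (n + 1) := by
  choose s hs using exists_adm hpp
  refine ⟨fun i => if i ≤ n then w (j + i) else s^[i - n] (w (j + n)), fun i => ?_, 0,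
    fun i => ?_⟩
  · simp only
    rcases lt_trichotomy i n with hi | rfl | hi
    · rw [if_pos hi.le, if_pos (Nat.succ_le_of_lt hi)]
      exact h (j + i) (by omega) (by omega)
    · rw [if_pos le_rfl, if_neg (by omega), Nat.add_sub_cancel_left]
      exact hs _
    · rw [if_neg (by omega), if_neg (by omega), Nat.sub_add_comm hi.le,
        Function.iterate_succ_apply']
      exact hs _
  · simp only
    rw [if_pos (by omega), zero_add]

lemma AdmOn.wordOver (hpp : M.ProperlyParametrized) {C : Set M.A} {w : ℕ → M.A} {α β j n : ℕ}
    (h : M.AdmOn C w α β) (hj : α ≤ j) (hn : j + n ≤ β) :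
    M.WordOver (fun i : Fin (n + 1) => w (j + i)) C :=
  ⟨word_mem_Lang hpp fun i h1 h2 => h.2 i (by omega) (by omega),
    fun i => h.1 _ (by omega) (by omega)⟩

lemma WordOver.exists_admOn {C : Set M.A} {n : ℕ} {u : Fin (n + 1) → M.A} (h : M.WordOver u C)
    (β : ℕ) : ∃ w, M.AdmOn C w β (β + n) ∧ ∀ i : Fin (n + 1), w (β + i) = u i := by
  obtain ⟨⟨z, hz, m, hm⟩, hC⟩ := h
  refine ⟨fun i => z (m + (i - β)), ⟨fun i h1 h2 => ?_, fun i h1 _ => ?_⟩, fun i => ?_⟩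
  · have := hC ⟨i - β, by omega⟩
    rwa [hm] at this
  · have := hz (m + (i - β))
    rwa [add_assoc, ← Nat.sub_add_comm h1] at this
  · simp [hm]

lemma AdmOn.glue {C : Set M.A} {w s : ℕ → M.A} {α β γ : ℕ} (hw : M.AdmOn C w α β)
    (hs : M.AdmOn C s β γ) (h : w β = s β) :
    M.AdmOn C (fun i => if i ≤ β then w i else s i) α γ := by
  refine ⟨fun i h1 h2 => ?_, fun i h1 h2 => ?_⟩
  · simp only
    split_ifs with hi
    · exact hw.1 i h1 hi
    · exact hs.1 i (by omega) h2
  · simp only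
    rcases lt_trichotomy i β with hi | rfl | hi
    · rw [if_pos hi.le, if_pos (Nat.succ_le_of_lt hi)]
      exact hw.2 i h1 hi
    · rw [if_pos le_rfl, if_neg (by omega), h]
      exact hs.2 i le_rfl h2
    · rw [if_neg (by omega), if_neg (by omega)]
      exact hs.2 i hi.le h2

lemma AdmOn.mono {C C' : Set M.A} {w : ℕ → M.A} {α β α' β' : ℕ} (hw : M.AdmOn C w α β)
    (hC : C ⊆ C') (hα : α ≤ α') (hβ : β' ≤ β) : M.AdmOn C' w α' β' :=
  ⟨fun i h1 h2 => hC (hw.1 i (by omega) (by omega)), fun i h1 h2 => hw.2 i (by omega) (by omega)⟩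

lemma AdmOn.shift {C : Set M.A} {w : ℕ → M.A} {α β : ℕ} (hw : M.AdmOn C w α β) {δ γ n : ℕ}
    (hα : α + n = β) (hγ : δ + n = γ) : M.AdmOn C (fun i => w (α + (i - δ))) δ γ := by
  refine ⟨fun i h1 h2 => hw.1 _ (by omega) (by omega), fun i h1 h2 => ?_⟩
  have := hw.2 (α + (i - δ)) (by omega) (by omega)
  rwa [add_assoc, ← Nat.sub_add_comm h1] at this

/-- `N` is a mixing time for the set of symbols `C`. -/
def MixTime (M : MarkovMultiMap) (C : Set M.A) (N : ℕ) : Prop :=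
  ∀ a ∈ C, ∀ b ∈ C, ∀ β γ, β + N ≤ γ → ∃ w, M.AdmOn C w β γ ∧ w β = a ∧ w γ = b

lemma MixingSet.exists_mixTime {C : Set M.A} (h : M.MixingSet C) : ∃ N, M.MixTime C N := by
  obtain ⟨N, -, hN⟩ := h
  refine ⟨N, fun a ha b hb β γ hγ => ?_⟩
  obtain ⟨u, hu, hua, hub⟩ := hN a ha b hb (γ - β) (by omega)
  obtain ⟨w, hw, hwu⟩ := hu.exists_admOn β
  have e : β + (γ - β) = γ := by omega
  rw [e] at hw
  refine ⟨w, hw, ?_, ?_⟩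
  · simpa [hua] using hwu 0
  · simpa [hub, e] using hwu (Fin.last _)

/-- A set of symbols containing a mixing set `C`, each of whose symbols can be joined to and
from a symbol of `C`, is mixing. -/
lemma mixingSet_of_joined (hpp : M.ProperlyParametrized) {C C' : Set M.A} {N : ℕ}
    (hC : M.MixTime C N) (hCC : C ⊆ C') {c : M.A} (hc : c ∈ C)
    (hto : ∀ a ∈ C', ∃ n w, M.AdmOn C' w 0 n ∧ w 0 = a ∧ w n = c)
    (hfrom : ∀ a ∈ C', ∃ n w, M.AdmOn C' w 0 n ∧ w 0 = c ∧ w n = a) : M.MixingSet C' := by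
  have := M.finA
  have bdd : ∀ p : M.A → ℕ → Prop, (∀ a ∈ C', ∃ n, p a n) →
      ∃ K, ∀ a ∈ C', ∃ n ≤ K, p a n := by
    intro p hp
    have hp' : ∀ a, ∃ n, a ∈ C' → p a n := fun a => by
      by_cases ha : a ∈ C'
      · exact (hp a ha).imp fun n hn _ => hn
      · exact ⟨0, fun h => absurd h ha⟩
    choose t ht using hp'
    obtain ⟨K, hK⟩ := (finite_range t).bddAbove
    exact ⟨K, fun a ha => ⟨t a, hK ⟨a, rfl⟩, ht a ha⟩⟩
  obtain ⟨K, hK⟩ := bdd _ hto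
  obtain ⟨L, hL⟩ := bdd _ hfrom
  refine ⟨K + N + L + 1, by omega, fun a ha b hb n hn => ?_⟩
  obtain ⟨k, hk, w, hw, hw0, hwk⟩ := hK a ha
  obtain ⟨l, hl, s, hs, hs0, hsl⟩ := hL b hb
  obtain ⟨t, ht, htk, htl⟩ := hC c hc c hc k (n - l) (by omega)
  have h1 := hw.glue (ht.mono hCC le_rfl le_rfl) (hwk.trans htk.symm)
  have h2 := h1.glue (hs.shift (zero_add l) (δ := n - l) (γ := n) (by omega)) (by
    simp only [Nat.sub_self, add_zero, hs0]
    split_ifs with h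
    · rw [show n - l = k by omega, hwk]
    · exact htl)
  refine ⟨_, h2.wordOver hpp (j := 0) le_rfl (zero_add n).le, ?_, ?_⟩
  · simp [hw0]
  · simp only [Fin.val_last, zero_add]
    split_ifs with h3 h4
    · have e1 : n = k := by omega
      have e2 : l = 0 := by omega
      rw [e1, hwk, ← hs0, ← hsl, e2]
    · have e2 : l = 0 := by omega
      rw [e2, Nat.sub_zero] at htl
      rw [htl, ← hs0, ← hsl, e2]
    · rw [show n - (n - l) = l by omega, hsl]

/-- A chain of admissible blocks separated by gaps of at least the mixing time can be
interpolated. -/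
lemma MixTime.exists_chain {C : Set M.A} {N : ℕ} (hC : M.MixTime C N) (a e : ℕ → ℕ)
    (s : ℕ → ℕ → M.A) (l : ℕ) (hs : ∀ k ≤ l, a k ≤ e k ∧ M.AdmOn C (s k) (a k) (e k))
    (hgap : ∀ k < l, e k + N ≤ a (k + 1)) :
    a 0 ≤ e l ∧ ∃ w, M.AdmOn C w (a 0) (e l) ∧
      ∀ k ≤ l, ∀ i, a k ≤ i → i ≤ e k → a 0 ≤ i ∧ i ≤ e l ∧ w i = s k i := by
  induction l with
  | zero =>
    refine ⟨(hs 0 le_rfl).1, s 0, (hs 0 le_rfl).2, fun k hk i h1 h2 => ?_⟩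
    obtain rfl : k = 0 := by omega
    exact ⟨h1, h2, rfl⟩
  | succ l ih =>
    obtain ⟨hle, w, hw, hws⟩ := ih (fun k hk => hs k (by omega)) (fun k hk => hgap k (by omega))
    obtain ⟨h1, h2⟩ := hs (l + 1) le_rfl
    have h3 := hgap l (by omega)
    obtain ⟨t, ht, ht1, ht2⟩ := hC (w (e l)) (hw.1 _ hle le_rfl) (s (l + 1) (a (l + 1)))
      (h2.1 _ le_rfl h1) _ _ h3
    have h4 := (hw.glue ht ht1.symm).glue h2 (by
      split_ifs with h
      · rw [← ht2, show a (l + 1) = e l by omega, ht1]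
      · exact ht2)
    refine ⟨by omega, _, h4, fun k hk i hi1 hi2 => ?_⟩
    rcases Nat.lt_or_ge k (l + 1) with hk' | hk'
    · obtain ⟨h0, h5, h6⟩ := hws k (by omega) i hi1 hi2
      refine ⟨h0, by omega, ?_⟩
      rw [if_pos (by omega), if_pos h5, h6]
    · obtain rfl : k = l + 1 := by omega
      refine ⟨by omega, hi2, ?_⟩
      rcases eq_or_lt_of_le hi1 with rfl | hi
      · rw [if_pos le_rfl]
        split_ifs with h
        · rw [← ht2, show a (l + 1) = e l by omega, ht1]
        · exact ht2
      · rw [if_neg (by omega)]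

/-! ### Essential labels -/

lemma SpecialLabeled.mem_Lang (hpp : M.ProperlyParametrized) {n : ℕ} {x : Fin (n + 2) → ℝ}
    {u : Fin (n + 1) → M.A} (h : M.SpecialLabeled x u) : u ∈ M.Lang (n + 1) := by
  have key := word_mem_Lang hpp (w := fun i => if hi : i < n + 1 then u ⟨i, hi⟩ else u 0)
    (j := 0) (n := n) fun i _ hi => by
      rw [dif_pos (by omega), dif_pos (by omega)]
      exact adm_of_mem (mem_of_mem_G0 (h ⟨i, by omega⟩)).2
        (mem_of_mem_G0 (h ⟨i + 1, by omega⟩)).1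
  convert key using 2 with i
  simp [i.is_lt]

lemma exists_specialLabeled (hpp : M.ProperlyParametrized) {n : ℕ} {x : Fin (n + 1) → ℝ}
    (hx : x ∈ M.finTraj (n + 1)) : ∃ u, M.SpecialLabeled x u := by
  have : ∀ i : Fin n, ∃ a, (x i.castSucc, x i.succ) ∈ M.G0 a := fun i =>
    exists_mem_G0 hpp (hx.2 i.castSucc (by simp))
  choose u hu using this
  exact ⟨u, hu⟩

lemma SpecialLabeled.labeled {n : ℕ} {x : Fin (n + 1) → ℝ} {u : Fin n → M.A}
    (h : M.SpecialLabeled x u) : M.Labeled x u := fun i => G0_subset_Gr _ (h i)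

lemma isClosed_labeled {n : ℕ} (u : Fin n → M.A) :
    IsClosed {x : M.finTraj (n + 1) | M.Labeled x.1 u} := by
  have : {x : M.finTraj (n + 1) | M.Labeled x.1 u} =
      ⋂ i, (fun x : M.finTraj (n + 1) => (x.1 i.castSucc, x.1 i.succ)) ⁻¹' M.Gr (u i) := by
    ext x
    simp [Labeled]
  rw [this]
  exact isClosed_iInter fun i => (isClosed_Gr _).preimage (by
    have h (j : Fin (n + 1)) : Continuous fun x : M.finTraj (n + 1) => x.1 j :=
      (continuous_apply j).comp continuous_subtype_val
    exact (h _).prodMk (h _))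

/-- Every finite trajectory is labeled by an essential word. -/
lemma exists_essentialWord (hpp : M.ProperlyParametrized) {n : ℕ} {y : Fin (n + 2) → ℝ}
    (hy : y ∈ M.finTraj (n + 2)) : ∃ u : Fin (n + 1) → M.A, M.EssentialWord u ∧ M.Labeled y u := by
  have := M.finA
  obtain ⟨u, ⟨hyu, w, hw, hwu⟩, hmin⟩ := Set.exists_min_image
    {u : Fin (n + 1) → M.A | M.Labeled y u ∧ ∃ w ∈ M.finTraj (n + 2), M.SpecialLabeled w u}
    (fun u => {i | u i ∈ M.A2}.ncard) (toFinite _)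
    ((exists_specialLabeled hpp hy).imp fun u hu => ⟨hu.labeled, y, hy, hu⟩)
  refine ⟨u, ⟨hwu.mem_Lang hpp, ?_⟩, hyu⟩
  have hkey : ∀ v, v ≠ u → (∃ w ∈ M.finTraj (n + 2), M.SpecialLabeled w v) →
      ∀ x : Fin (n + 2) → ℝ, M.SpecialLabeled x u → ¬ M.Labeled x v := by
    intro v hvu hv x hxu hxv
    have hi : ∀ i, u i = v i ∨ (u i ∈ M.A2 ∧ v i ∉ M.A2) := fun i =>
      eq_or_mem_A2 hpp (hxu i) (hxv i)
    have hyv : M.Labeled y v := by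
      intro i
      rcases hi i with h | h
      · exact h ▸ hyu i
      · rw [eq_of_mem_Gr_A2 h.1 (hyu i) (G0_subset_Gr _ (hxu i))]
        exact hxv i
    refine absurd (hmin v ⟨hyv, hv⟩) (not_le.2 (ncard_lt_ncard ?_ (toFinite _)))
    obtain ⟨j, hj⟩ := Function.ne_iff.1 hvu
    refine ⟨fun i h => ?_, fun h => ?_⟩
    · rcases hi i with h' | h'
      · exact (h'.symm ▸ h : u i ∈ M.A2)
      · exact absurd h h'.2
    · rcases hi j with h' | h'
      · exact hj h'.symm
      · exact h'.2 (h h'.1)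
  have heq : {x : M.finTraj (n + 2) | M.SpecialLabeled x.1 u} =
      (⋃ v ∈ {v | v ≠ u ∧ ∃ w ∈ M.finTraj (n + 2), M.SpecialLabeled w v},
        {x : M.finTraj (n + 2) | M.Labeled x.1 v})ᶜ := by
    ext x
    simp only [mem_compl_iff, mem_iUnion, not_exists]
    constructor
    · rintro hx v ⟨hv1, hv2⟩
      exact hkey v hv1 hv2 x.1 hx
    · intro h
      obtain ⟨v, hv⟩ := exists_specialLabeled hpp x.2
      by_cases hvu : v = u
      · exact hvu ▸ hv
      · exact absurd hv.labeled (h v ⟨hvu, x.1, x.2, hv⟩)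
  rw [heq, isOpen_compl_iff]
  exact (toFinite _).isClosed_biUnion fun v _ => isClosed_labeled v

/-- A trajectory is labeled, over any finite window, by an admissible word of essential
symbols. -/
lemma exists_essential_label (hpp : M.ProperlyParametrized) {x : ℕ → ℝ} (hx : x ∈ M.X)
    (α n : ℕ) : ∃ w, M.AdmOn M.Ess w α (α + n) ∧
      ∀ i, α ≤ i → i ≤ α + n → (x i, x (i + 1)) ∈ M.Gr (w i) := by
  obtain ⟨u, hu, hxu⟩ := exists_essentialWord hpp
    (y := fun i : Fin (n + 2) => x (α + i)) ⟨fun i => hx.1 _, fun i _ => hx.2 _⟩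
  obtain ⟨w, hw, hwu⟩ := WordOver.exists_admOn (C := M.Ess)
    ⟨hu.1, fun i => ⟨_, u, hu, i, rfl⟩⟩ α
  refine ⟨w, hw, fun i h1 h2 => ?_⟩
  have h3 := hxu ⟨i - α, by omega⟩
  rw [← hwu] at h3
  simp only [Fin.val_castSucc, Fin.val_succ, ← add_assoc] at h3
  rwa [show α + (i - α) = i by omega] at h3

/-- If a point outside of `P` starts a trajectory labeled by `a`, then `a` is essential. -/
lemma mem_Ess_of_mem_Gr (hpp : M.ProperlyParametrized) {x : ℕ → ℝ} (hx : x ∈ M.X)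
    (h0 : x 0 ∉ M.P) {a : M.A} (ha : (x 0, x 1) ∈ M.Gr a) : a ∈ M.Ess := by
  obtain ⟨w, hw, hxw⟩ := exists_essential_label hpp hx 0 0
  have hG0 : ∀ b, (x 0, x 1) ∈ M.Gr b → (x 0, x 1) ∈ M.G0 b := fun b hb => by
    by_contra h
    exact h0 (mem_P_of_mem_Gr hb h).2.1
  have h1 := hG0 _ (hxw 0 le_rfl le_rfl)
  rcases eq_or_mem_A2 hpp h1 ha with h | h
  · exact h ▸ hw.1 0 le_rfl le_rfl
  · obtain ⟨p, hp, u, -, -, hD0, -⟩ := shape_A2 h.1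
    have := (mem_of_mem_G0 h1).1
    rw [hD0, mem_singleton_iff] at this
    subst this
    exact absurd hp h0

/-- A shift which is transitive on symbols and meets a mixing component lies over it. -/
lemma MixingComponent.symbol_mem (hpp : M.ProperlyParametrized) {C : Set M.A}
    (hC : M.MixingComponent C) {Z : Set (ℕ → M.A)} (hZ : Z ⊆ M.SFT)
    (hZt : M.TransitiveOnSymbols Z) {c : M.A} (hc : c ∈ C) (hcZ : M.SymbolInShift Z c) {b : M.A}
    (hb : M.SymbolInShift Z b) : b ∈ C := by
  obtain ⟨N, hN⟩ := hC.1.exists_mixTime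
  have hpath : ∀ a b, M.SymbolInShift Z a → M.SymbolInShift Z b →
      ∃ n w, M.AdmOn (C ∪ {b | M.SymbolInShift Z b}) w 0 n ∧ w 0 = a ∧ w n = b := by
    intro a b ha hb
    obtain ⟨z, hz, m, n, h1, h2⟩ := hZt a b ha hb
    exact ⟨n, fun i => z (m + i), ⟨fun i _ _ => Or.inr ⟨z, hz, _, rfl⟩, fun i _ _ => hZ hz _⟩,
      h1, h2⟩
  have hmix : ∀ a b, a ∈ C → b ∈ C →
      ∃ n w, M.AdmOn (C ∪ {b | M.SymbolInShift Z b}) w 0 n ∧ w 0 = a ∧ w n = b := by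
    intro a b ha hb
    obtain ⟨w, hw, h⟩ := hN a ha b hb 0 N (by omega)
    exact ⟨N, w, hw.mono subset_union_left le_rfl le_rfl, h⟩
  have := hC.2 _ (mixingSet_of_joined hpp hN subset_union_left hc
    (fun a ha => ha.elim (fun h => hmix a c h hc) fun h => hpath a c h hcZ)
    fun a ha => ha.elim (fun h => hmix c a hc h) fun h => hpath c a hcZ h) subset_union_left
  rw [← this]
  exact Or.inr hb

/-- The sequence `z` is labeled by `w` on the index interval `[α, β)`. -/
def Follows (M : MarkovMultiMap) (z : ℕ → ℝ) (w : ℕ → M.A) (α β : ℕ) : Prop :=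
  ∀ i, α ≤ i → i < β → (z i, z (i + 1)) ∈ M.Gr (w i)

lemma Follows.gWordList_eq {z : ℕ → ℝ} {w : ℕ → M.A} {α n : ℕ} (h : M.Follows z w α (α + n)) :
    gWordList M (List.ofFn fun i : Fin n => w (α + i)) (z (α + n)) = z α := by
  induction n generalizing α with
  | zero => simp [gWordList]
  | succ n ih =>
    have h1 := ih (α := α + 1) fun i h1 h2 => h i (by omega) (by omega)
    have h2 := (mem_Gr_iff.1 (h α le_rfl (by omega))).2
    simp only [List.ofFn_succ, gWordList, Fin.val_zero, Fin.val_succ, add_zero]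
    rw [show α + (n + 1) = α + 1 + n by omega, h2, ← h1]
    simp only [add_assoc, add_comm 1]

lemma Follows.mem_R {z : ℕ → ℝ} {w : ℕ → M.A} {α β i : ℕ} (h : M.Follows z w α β)
    (h1 : α ≤ i) (h2 : i < β) : z (i + 1) ∈ M.R (w i) :=
  (mem_Gr_iff.1 (h i h1 h2)).1

lemma Follows.gWord_eq {z : ℕ → ℝ} {w : ℕ → M.A} {α n : ℕ}
    (h : M.Follows z w α (α + (n + 1))) :
    M.gWord (fun i : Fin (n + 1) => w (α + i)) (z (α + n + 1)) = z α :=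
  h.gWordList_eq

lemma gWordList_mem_D {w : ℕ → M.A} {α n : ℕ}
    (hw : ∀ i, α ≤ i → i < α + n → M.Adm (w i) (w (i + 1))) {x : ℝ}
    (hx : x ∈ M.R (w (α + n))) :
    gWordList M (List.ofFn fun i : Fin (n + 1) => w (α + i)) x ∈ M.D (w α) := by
  induction n generalizing α with
  | zero => simpa [gWordList] using g_mem_D hx
  | succ n ih =>
    have h1 := ih (α := α + 1) (fun i h1 h2 => hw i (by omega) (by omega))
      (by rwa [add_assoc, add_comm 1 n])
    rw [List.ofFn_succ]
    simp only [gWordList, Fin.val_zero, Fin.val_succ, add_zero]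
    apply g_mem_D
    simp only [add_assoc, add_comm 1] at h1
    exact (hw α le_rfl (by omega)).D_subset_R h1

lemma abs_sub_le_intervalLen {n : ℕ} {u : Fin (n + 1) → M.A} {C : Set M.A} (hu : M.WordOver u C)
    {x y : ℝ} (hx : x ∈ M.Iword u) (hy : y ∈ M.Iword u) : |x - y| ≤ intervalLen (M.Iword u) := by
  obtain ⟨w, hw, hwu⟩ := hu.exists_admOn 0
  have hsub : M.Iword u ⊆ Icc 0 1 := by
    rintro _ ⟨t, ht, rfl⟩
    have e : u = fun i : Fin (n + 1) => w (0 + i) := funext fun i => (hwu i).symm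
    rw [e] at ht ⊢
    exact D_subset _ (gWordList_mem_D (fun i h1 h2 => hw.2 i h1 h2) ht)
  have hb : BddBelow (M.Iword u) := ⟨0, fun t ht => (hsub ht).1⟩
  have ha : BddAbove (M.Iword u) := ⟨1, fun t ht => (hsub ht).2⟩
  have h1 := csInf_le hb hx
  have h2 := csInf_le hb hy
  have h3 := le_csSup ha hx
  have h4 := le_csSup ha hy
  unfold intervalLen
  rw [abs_le]
  constructor <;> linarith

/-- By the coding condition, an admissible continuation of bounded length pins down the current
position up to `δ`. -/
lemma CC.exists_tail (hpp : M.ProperlyParametrized) (hcc : M.CC) {C : Set M.A}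
    (hC : M.MixingComponent C) (hsub : M.Ess ⊆ C) {δ : ℝ} (hδ : 0 < δ) :
    ∃ N, ∀ c ∈ C, ∀ y ∈ M.R c, ∀ β, ∃ v, M.AdmOn C v β (β + N + 1) ∧ v β = c ∧
      ∀ z, M.Follows z v β (β + N + 2) → |z (β + 1) - y| < δ := by
  obtain ⟨Z, ⟨hZ, -, -⟩, hZt, hZc, hZl⟩ := hcc
  obtain ⟨N, hN⟩ := hZl (δ / 2) (by linarith)
  obtain ⟨K, hK⟩ := hC.1.exists_mixTime
  have hstart : ∀ y ∈ Icc (0 : ℝ) 1, y ∉ M.P → ∃ a ∈ Z, ∃ x ∈ M.X, x 0 = y ∧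
      (∀ i, (x i, x (i + 1)) ∈ M.Gr (a i)) ∧ a 0 ∈ C := by
    intro y hy hyP
    obtain ⟨a, ha, x, hx, rfl, hxa⟩ := hZc y hy
    exact ⟨a, ha, x, hx, rfl, hxa, hsub (mem_Ess_of_mem_Gr hpp hx hyP (hxa 0))⟩
  refine ⟨N + K, fun c hc y hy β => ?_⟩
  rcases R_shape c with ⟨u, hu, hR, hR0⟩ | ⟨u, hu, v, hv, huv, hR, hR0⟩
  · obtain ⟨w, hw, hw0, -⟩ := hK c hc c hc β (β + (N + K) + 1) (by omega)
    refine ⟨w, hw, hw0, fun z hz => ?_⟩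
    have h1 := hz.mem_R le_rfl (by omega)
    rw [hw0, hR] at h1
    rw [hR] at hy
    rw [mem_singleton_iff.1 h1, mem_singleton_iff.1 hy]
    simpa using hδ
  · rw [hR] at hy
    have hne : max u (y - δ / 2) < min v (y + δ / 2) :=
      max_lt (lt_min huv (by linarith [hy.1])) (lt_min (by linarith [hy.2]) (by linarith))
    obtain ⟨t, ⟨ht1, ht2⟩, htP⟩ := (Ioo_infinite hne).exists_notMem_finset M.P
    rw [max_lt_iff] at ht1
    rw [lt_min_iff] at ht2
    have htR : t ∈ M.R0 c := hR0 ▸ ⟨ht1.1, ht2.1⟩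
    obtain ⟨a, ha, x, hx, rfl, hxa, haC⟩ := hstart t (R_subset c (R0_subset_R c htR)) htP
    have haC' : ∀ i, a i ∈ C := fun i =>
      hC.symbol_mem hpp hZ hZt haC ⟨a, ha, 0, rfl⟩ ⟨a, ha, i, rfl⟩
    have hca : M.Adm c (a 0) := by
      refine adm_of_mem htR (mem_of_mem_G0 (q := (x 0, x 1)) ?_).1
      by_contra h
      exact htP (mem_P_of_mem_Gr (hxa 0) h).2.1
    refine ⟨fun i => if i ≤ β then c else a (i - (β + 1)), ⟨fun i _ _ => ?_, fun i h1 _ => ?_⟩,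
      if_pos le_rfl, fun z hz => ?_⟩
    · simp only
      split_ifs
      · exact hc
      · exact haC' _
    · simp only
      rcases eq_or_lt_of_le h1 with rfl | h1
      · rw [if_pos le_rfl, if_neg (by omega), Nat.sub_self]
        exact hca
      · rw [if_neg (by omega), if_neg (by omega), Nat.sub_add_comm (by omega)]
        exact hZ ha _
    · have hza : M.Follows (fun i => z (β + 1 + i)) a 0 (0 + (N + K + 1)) := fun i _ hi => by
        have := hz (β + 1 + i) (by omega) (by omega)
        beta_reduce at this
        rwa [if_neg (by omega), Nat.add_sub_cancel_left] at this
      have hxa' : M.Follows x a 0 (0 + (N + K + 1)) := fun i _ _ => hxa i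
      have h1 := abs_sub_le_intervalLen
        (u := fun i : Fin (N + K + 1) => a (0 + i)) (C := C)
        ⟨⟨a, hZ ha, 0, fun i => rfl⟩, fun i => haC' _⟩
        ⟨_, hza.mem_R (i := 0 + (N + K)) (by omega) (by omega), hza.gWord_eq⟩
        ⟨_, hxa'.mem_R (i := 0 + (N + K)) (by omega) (by omega), hxa'.gWord_eq⟩
      have h2 := hN (N + K) (by omega) (fun i : Fin (N + K + 1) => a (0 + i))
        ⟨a, ha, 0, fun i => rfl⟩
      have h3 : |x 0 - y| < δ / 2 := abs_lt.2 ⟨by linarith [ht1.2], by linarith [ht2.2]⟩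
      have h4 := abs_sub_le (z (β + 1)) (x 0) y
      simp only [add_zero] at h1
      linarith

lemma UnifEquicontOn.exists_block (hpp : M.ProperlyParametrized) (hcc : M.CC) {C : Set M.A}
    (hC : M.MixingComponent C) (hsub : M.Ess ⊆ C) (hequi : M.UnifEquicontOn C) {ε : ℝ}
    (hε : 0 < ε) : ∃ N, ∀ x ∈ M.X, ∀ α γ, α ≤ γ → ∃ s, M.AdmOn C s α (γ + N) ∧
      ∀ z, M.Follows z s α (γ + N + 1) → ∀ i, α ≤ i → i ≤ γ → |z i - x i| < ε := by
  obtain ⟨δ, hδ, hδε⟩ := hequi ε hε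
  obtain ⟨N, hN⟩ := hcc.exists_tail hpp hC hsub hδ
  refine ⟨N + 1, fun x hx α γ hαγ => ?_⟩
  obtain ⟨w, hw, hxw⟩ := exists_essential_label hpp hx α (γ - α)
  rw [Nat.add_sub_cancel' hαγ] at hw hxw
  replace hxw : M.Follows x w α (γ + 1) := fun i h1 h2 => hxw i h1 (by omega)
  replace hw := hw.mono hsub le_rfl le_rfl
  obtain ⟨v, hv, hvw, hvz⟩ := hN (w γ) (hw.1 _ hαγ le_rfl) _ (hxw.mem_R hαγ (by omega)) γ
  refine ⟨_, hw.glue hv hvw.symm, fun z hz i h1 h2 => ?_⟩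
  have hzw : M.Follows z w α (γ + 1) := fun j hj1 hj2 => by
    have := hz j hj1 (by omega)
    beta_reduce at this
    rwa [if_pos (by omega)] at this
  have hzv : M.Follows z v γ (γ + N + 2) := fun j hj1 hj2 => by
    have := hz j (by omega) (by omega)
    beta_reduce at this
    split_ifs at this with h
    · obtain rfl : j = γ := by omega
      rwa [hvw]
    · exact this
  obtain ⟨n, rfl⟩ : ∃ n, γ = i + n := ⟨γ - i, by omega⟩
  have hfin : ∀ {t : ℕ → ℝ}, M.Follows t w α (i + n + 1) → M.Follows t w i (i + (n + 1)) :=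
    fun h j hj1 hj2 => h j (by omega) (by omega)
  have := hδε n _ (hw.wordOver hpp h1 le_rfl) _ (hzw.mem_R hαγ (by omega)) _
    (hxw.mem_R hαγ (by omega)) (hvz z hzv)
  rwa [Fin.val_last, (hfin hzw).gWord_eq, (hfin hxw).gWord_eq] at this

lemma UnifEquicontOn.continuousOn {C : Set M.A} (hequi : M.UnifEquicontOn C) {n : ℕ}
    {u : Fin (n + 1) → M.A} (hu : M.WordOver u C) :
    ContinuousOn (M.gWord u) (M.R (u (Fin.last n))) := by
  rw [Metric.continuousOn_iff]
  intro y hy ε hε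
  obtain ⟨δ, hδ, h⟩ := hequi ε hε
  exact ⟨δ, hδ, fun x hx hxy => h n u hu x hx y hy hxy⟩

lemma exists_periodic_zero (hpp : M.ProperlyParametrized) {C : Set M.A}
    (hequi : M.UnifEquicontOn C) {w : ℕ → M.A} {q : ℕ} (hw : M.AdmOn C w 0 (q + 1))
    (hper : w (q + 1) = w 0) :
    ∃ z ∈ M.X, Function.Periodic z (q + 1) ∧ M.Follows z w 0 (q + 1) := by
  obtain ⟨y, hyR, hy⟩ : ∃ y ∈ M.R (w q), M.gWord (fun i : Fin (q + 1) => w (0 + i)) y = y := by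
    have hcont := hequi.continuousOn (hw.wordOver hpp (j := 0) (n := q) le_rfl (by omega))
    have hmaps : MapsTo (M.gWord fun i : Fin (q + 1) => w (0 + i)) (M.R (w q)) (M.R (w q)) := by
      intro x hx
      have h1 := hw.2 q (by omega) (by omega)
      rw [hper] at h1
      exact h1.D_subset_R
        (gWordList_mem_D (fun i h1 h2 => hw.2 i h1 (by omega)) (by rwa [zero_add]))
    simp only [Fin.val_last, zero_add] at hcont
    simp only [zero_add] at hmaps ⊢
    obtain ⟨u, v, huv, hR⟩ : ∃ u v, u ≤ v ∧ M.R (w q) = Icc u v := by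
      rcases R_shape (w q) with ⟨u, -, hR, -⟩ | ⟨u, -, v, -, huv, hR, -⟩
      · exact ⟨u, u, le_rfl, by rw [hR, Icc_self]⟩
      · exact ⟨u, v, huv.le, hR⟩
    rw [hR] at hcont hmaps ⊢
    exact exists_mem_Icc_isFixedPt_of_mapsTo hcont huv hmaps
  obtain ⟨h, hh⟩ : ∃ h : ℕ → ℕ → ℝ, ∀ n j,
      h n j = gWordList M (List.ofFn fun i : Fin n => w (j + i)) y := ⟨_, fun _ _ => rfl⟩
  have hzero : ∀ j, h 0 j = y := fun j => by simp [hh, gWordList]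
  have hfix : h (q + 1) 0 = y := by
    rw [hh]
    exact hy
  have hstep : ∀ j n, j + n = q → (h (n + 1) j, h n (j + 1)) ∈ M.Gr (w j) := by
    rintro j n rfl
    refine mem_Gr_iff.2 ⟨?_, ?_⟩
    · cases n with
      | zero => rwa [hzero]
      | succ n =>
        rw [hh]
        refine (hw.2 j (by omega) (by omega)).D_subset_R
          (gWordList_mem_D (fun i h1 h2 => hw.2 i (by omega) (by omega)) ?_)
        rwa [add_assoc, add_comm 1 n]
    · simp only [hh, List.ofFn_succ, gWordList, Fin.val_zero, Fin.val_succ, add_zero, add_assoc,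
        add_comm 1]
  have hz : ∀ i, (h (q + 1 - i % (q + 1)) (i % (q + 1)),
      h (q + 1 - (i + 1) % (q + 1)) ((i + 1) % (q + 1))) ∈ M.Gr (w (i % (q + 1))) := by
    intro i
    have hj : i % (q + 1) < q + 1 := Nat.mod_lt _ (by omega)
    rw [Nat.add_mod i 1, Nat.add_mod_mod]
    generalize i % (q + 1) = j at hj ⊢
    have h1 := hstep j (q - j) (by omega)
    rw [show q - j + 1 = q + 1 - j by omega] at h1
    rcases Nat.lt_or_ge j q with hjq | hjq
    · rw [Nat.mod_eq_of_lt (a := j + 1) (by omega), show q + 1 - (j + 1) = q - j by omega]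
      exact h1
    · obtain rfl : j = q := by omega
      rw [Nat.mod_self, Nat.sub_zero, hfix]
      rwa [Nat.sub_self, hzero] at h1
  refine ⟨fun i => h (q + 1 - i % (q + 1)) (i % (q + 1)),
    ⟨fun i => D_subset _ (mem_D_of_mem_Gr (hz i)), fun i => mem_iUnion.2 ⟨_, hz i⟩⟩,
    fun i => by simp only [Nat.add_mod_right], fun i _ hi => ?_⟩
  have := hz i
  beta_reduce
  rwa [Nat.mod_eq_of_lt hi] at this ⊢

/-- A closed admissible path labels a periodic trajectory. -/
lemma exists_periodic (hpp : M.ProperlyParametrized) {C : Set M.A}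
    (hequi : M.UnifEquicontOn C) {w : ℕ → M.A} {α p : ℕ} (hp : 0 < p)
    (hw : M.AdmOn C w α (α + p)) (hper : w (α + p) = w α) :
    ∃ z ∈ M.X, Function.Periodic z p ∧ M.Follows z w α (α + p) := by
  obtain ⟨q, rfl⟩ : ∃ q, p = q + 1 := ⟨p - 1, by omega⟩
  obtain ⟨z, hz, hzp, hzw⟩ := exists_periodic_zero hpp hequi
    (hw.shift rfl (zero_add (q + 1))) (by simpa using hper)
  refine ⟨fun i => z (i + q * α), ⟨fun i => hz.1 _, fun i => ?_⟩, fun i => ?_, fun i h1 h2 => ?_⟩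
  · have := hz.2 (i + q * α)
    rwa [add_right_comm] at this
  · simp only
    rw [add_right_comm, hzp]
  · have h3 := hzw (i - α) (by omega) (by omega)
    have h4 : ∀ j, z (α + j + q * α) = z j := fun j => by
      have := hzp.nat_mul α j
      rw [← this]
      congr 1
      push_cast
      ring
    obtain ⟨j, rfl⟩ : ∃ j, i = α + j := ⟨i - α, by omega⟩
    simp only [add_assoc α j 1, h4]
    simpa using h3

lemma shift_iterate_apply (x : M.X) (n k : ℕ) : (M.shift^[n] x).1 k = x.1 (k + n) := by
  induction n generalizing x with
  | zero => rfl
  | succ n ih =>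
    rw [Function.iterate_succ_apply, ih]
    exact congrArg x.1 (add_assoc k n 1)

end MarkovMultiMap

lemma dseq_le {x y : ℕ → ℝ} {c : ℝ} {m : ℕ} (hx : ∀ k, x k ∈ Icc (0 : ℝ) 1)
    (hy : ∀ k, y k ∈ Icc (0 : ℝ) 1) (hm : 1 / ((m : ℝ) + 1) ≤ c)
    (h : ∀ k ≤ m, |x k - y k| ≤ c) : dseq x y ≤ c := by
  refine ciSup_le fun k => ?_
  have hk : (1 : ℝ) ≤ (k : ℝ) + 1 := by linarith [Nat.cast_nonneg (α := ℝ) k]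
  rcases le_total k m with hkm | hkm
  · exact (div_le_self (abs_nonneg _) hk).trans (h k hkm)
  · have h1 : |x k - y k| ≤ 1 := by
      rw [abs_le]
      constructor <;> linarith [(hx k).1, (hx k).2, (hy k).1, (hy k).2]
    have h2 : (m : ℝ) ≤ k := by exact_mod_cast hkm
    calc |x k - y k| / ((k : ℝ) + 1) ≤ 1 / ((m : ℝ) + 1) := by gcongr
      _ ≤ c := hm

/-- If `Σ_M` satisfies (CC) and (MC) with mixing component `C₀ ⊇ A^(e)`, and the family
`{g_u : u ∈ L(C₀)}` is uniformly equicontinuous, then `(X,T)` has the specification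
property (with respect to the metric `d(x,y) = sup_k |x_k - y_k|/(k+1)`). -/
theorem stmt4 (M : MarkovMultiMap) (hpp : M.ProperlyParametrized)
    (hcc : M.CC) (C0 : Set M.A) (hmc : M.MixingComponent C0) (hsub : M.Ess ⊆ C0)
    (hequi : M.UnifEquicontOn C0) :
    SpecProp M.shift (fun x y => dseq x.1 y.1) := by
  intro ε hε
  obtain ⟨m, hm⟩ := exists_nat_one_div_lt (half_pos hε)
  obtain ⟨L, hL⟩ := hequi.exists_block hpp hcc hmc hsub (half_pos hε)
  obtain ⟨K, hK⟩ := hmc.1.exists_mixTime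
  refine ⟨m + L + K + 1, fun l x a b _ hab hgap p hp => ?_⟩
  have hblock : ∀ k, ∃ s, M.AdmOn C0 s (a k) (b k + m + L) ∧
      ∀ z, M.Follows z s (a k) (b k + m + L + 1) →
        ∀ i, a k ≤ i → i ≤ b k + m → |z i - (x k).1 i| < ε / 2 := fun k =>
    hL (x k).1 (x k).2 (a k) (b k + m) ((hab k).trans (Nat.le_add_right _ _))
  choose s hs hsz using hblock
  let φ : ℕ → Fin (l + 1) := fun k => ⟨min k l, by omega⟩
  have hφ : ∀ k : Fin (l + 1), φ k = k := fun k => Fin.ext (min_eq_left (by omega))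
  obtain ⟨hle, w, hw, hws⟩ := hK.exists_chain (fun k => a (φ k)) (fun k => b (φ k) + m + L)
    (fun k => s (φ k)) l
    (fun k _ => ⟨by have := hab (φ k); omega, hs (φ k)⟩) (fun k hk => by
      have h1 := (hgap ⟨k, hk⟩).2
      have h2 : φ k = Fin.castSucc ⟨k, hk⟩ := hφ (Fin.castSucc ⟨k, hk⟩)
      have h3 : φ (k + 1) = Fin.succ ⟨k, hk⟩ := hφ (Fin.succ ⟨k, hk⟩)
      simp only [h2, h3]
      omega)
  have hlast : φ l = Fin.last l := hφ (Fin.last l)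
  simp only [hlast] at hle hw hws
  obtain ⟨t, ht, ht1, ht2⟩ := hK (w (b (Fin.last l) + m + L)) (hw.1 _ hle le_rfl)
    (w (a (φ 0))) (hw.1 _ le_rfl hle) (b (Fin.last l) + m + L) (a (φ 0) + p) (by omega)
  obtain ⟨z, hz, hzp, hzw⟩ := MarkovMultiMap.exists_periodic hpp hequi (by omega)
    (hw.glue ht ht1.symm) (by rw [if_neg (by omega), if_pos hle, ht2])
  refine ⟨⟨z, hz⟩, Subtype.ext (funext fun i => ?_), fun k i hi1 hi2 => ?_⟩
  · rw [MarkovMultiMap.shift_iterate_apply]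
    exact hzp i
  · have hfol : M.Follows z (s k) (a k) (b k + m + L + 1) := fun j hj1 hj2 => by
      have hk := hws k (by omega) j
      rw [hφ k] at hk
      obtain ⟨h1, h2, h3⟩ := hk hj1 (by omega)
      have h4 := hzw j h1 (by omega)
      beta_reduce at h4
      rwa [if_pos h2, h3] at h4
    refine (dseq_le (M.shift^[i] ⟨z, hz⟩).2.1 (M.shift^[i] (x k)).2.1 hm.le fun j hj => ?_).trans_lt
      (half_lt_self hε)
    rw [MarkovMultiMap.shift_iterate_apply, MarkovMultiMap.shift_iterate_apply]
    exact (hsz k z hfol _ (by omega) (by omega)).le
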